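/- arXiv:2102.00231 — 2 statements merged into one kernel-verified Lean document; each statement's English description precedes it below -/
import Mathlib

section
/- Fix d ∈ (0,1) and define g^M(ω) = ω(d + d² − 3dω + ω²)/(d² + (1 − 2d)ω). Then g^M is monotone nondecreasing on the interval [0,1]. -/
/-- The WENO-M mapping function of Henrick et al. -/
noncomputable def gM (d ω : ℝ) : ℝ :=
  ω * (d + d ^ 2 - 3 * d * ω + ω ^ 2) / (d ^ 2 + (1 - 2 * d) * ω)

theorem gM_denom_pos {d ω : ℝ} (hd0 : 0 < d) (hd1 : d < 1) (hω : ω ∈ Set.Icc (0 : ℝ) 1) :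
    0 < d ^ 2 + (1 - 2 * d) * ω := by
  obtain ⟨h0, h1⟩ := hω
  have hd : 0 < (1 - d) ^ 2 := pow_pos (sub_pos.2 hd1) 2
  rcases h0.eq_or_lt with rfl | h0
  · simpa using pow_pos hd0 2
  · have : 0 ≤ d ^ 2 * (1 - ω) := mul_nonneg (sq_nonneg d) (sub_nonneg.2 h1)
    linarith [mul_pos hd h0]

theorem gM_eq_add_cube_div {d ω : ℝ} (h : d ^ 2 + (1 - 2 * d) * ω ≠ 0) :
    gM d ω = d + (ω - d) ^ 3 / (d ^ 2 + (1 - 2 * d) * ω) := by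
  rw [gM, div_eq_iff h, add_mul, div_mul_cancel₀ _ h]
  ring

theorem gM_monotone (d : ℝ) (hd0 : 0 < d) (hd1 : d < 1) :
    MonotoneOn (gM d) (Set.Icc (0 : ℝ) 1) := by
  intro x hx y hy hxy
  have hX := gM_denom_pos hd0 hd1 hx
  have hY := gM_denom_pos hd0 hd1 hy
  rw [gM_eq_add_cube_div hX.ne', gM_eq_add_cube_div hY.ne']
  gcongr d + ?_
  by_cases hsep : x ≤ d ∧ d ≤ y
  · exact (div_nonpos_of_nonpos_of_nonneg
      (Odd.pow_nonpos (by decide) (sub_nonpos.2 hsep.1)) hX.le).trans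
      (div_nonneg (pow_nonneg (sub_nonneg.2 hsep.2) 3) hY.le)
  · have huv : 0 ≤ (x - d) * (y - d) := by
      rcases le_total x d with h | h
      · have : y < d := not_le.1 fun h' => hsep ⟨h, h'⟩
        exact mul_nonneg_of_nonpos_of_nonpos (sub_nonpos.2 h) (sub_nonpos.2 this.le)
      · exact mul_nonneg (sub_nonneg.2 h) (sub_nonneg.2 (h.trans hxy))
    rw [div_le_div_iff₀ hX hY, ← sub_nonneg]
    have he : 0 ≤ d * (1 - d) := mul_nonneg hd0.le (sub_nonneg.2 hd1.le)
    have key : 0 ≤ (y - x) * ((y - d) ^ 2 * (d ^ 2 + (1 - 2 * d) * x)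
        + (x - d) ^ 2 * (d ^ 2 + (1 - 2 * d) * y) + d * (1 - d) * ((x - d) * (y - d))) :=
      mul_nonneg (sub_nonneg.2 hxy) (by positivity)
    linear_combination key
end

section
/- Fix d ∈ (0,1), a positive integer k, A > 0, CFS ∈ (0, d); set ĈFS = 1 − ((1 − d)/d)·CFS and let δ > 0 satisfy δ < min{CFS, d − CFS, (1 − d)(1 − CFS/d), ((1 − d)/d)·CFS}. Let g^ACM be the WENO-ACM mapping function. Then g^ACM is monotone nondecreasing on [0,1] and satisfies 0 ≤ g^ACM(ω) ≤ 1 for all ω ∈ [0,1]. -/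
/-- The signum-like function. -/
noncomputable def sgm (k : ℕ) (δ A x : ℝ) : ℝ :=
  if δ ≤ |x| then x / |x|
  else x / ((A * (δ ^ 2 - x ^ 2)) ^ (k + 3) + |x|)

/-- The right-side splicing point of the WENO-ACM mapping function. -/
noncomputable def CFSbar (d CFS : ℝ) : ℝ := 1 - (1 - d) / d * CFS

/-- The WENO-ACM mapping function. -/
noncomputable def gACM (d : ℝ) (k : ℕ) (A CFS δ : ℝ) (ω : ℝ) : ℝ :=
  if ω ≤ d then d / 2 * sgm k δ A (ω - CFS) + d / 2
  else (1 - d) / 2 * sgm k δ A (ω - CFSbar d CFS) + (1 + d) / 2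

theorem sgm_neg (k : ℕ) (δ A x : ℝ) : sgm k δ A (-x) = -sgm k δ A x := by
  unfold sgm
  rw [abs_neg, neg_sq]
  split_ifs <;> exact neg_div _ _

theorem abs_sgm_le_one (k : ℕ) {δ A : ℝ} (hA : 0 ≤ A) (x : ℝ) : |sgm k δ A x| ≤ 1 := by
  unfold sgm
  split_ifs with h
  · rw [abs_div, abs_abs]
    exact div_self_le_one _
  · have hp : 0 ≤ (A * (δ ^ 2 - x ^ 2)) ^ (k + 3) := by
      have : x ^ 2 ≤ δ ^ 2 := sq_le_sq.2 ((not_le.1 h).le.trans (le_abs_self δ))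
      exact pow_nonneg (mul_nonneg hA (sub_nonneg.2 this)) _
    rw [abs_div, abs_of_nonneg (add_nonneg hp (abs_nonneg x))]
    exact div_le_one_of_le₀ (le_add_of_nonneg_left hp) (add_nonneg hp (abs_nonneg x))

theorem sgm_monotone (k : ℕ) {δ A : ℝ} (hA : 0 < A) (hδ : 0 < δ) : Monotone (sgm k δ A) := by
  refine monotone_of_odd_of_monotoneOn_nonneg (sgm_neg k δ A) fun x hx y hy hxy => ?_
  rw [Set.mem_Ici] at hx hy
  rcases le_or_gt δ y with h | h
  · have hy1 : sgm k δ A y = 1 := by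
      rw [sgm, abs_of_nonneg hy, if_pos h, div_self (hδ.trans_le h).ne']
    exact hy1 ▸ (abs_le.1 (abs_sgm_le_one k hA.le x)).2
  · have hxδ : x < δ := hxy.trans_lt h
    have hpy : 0 < A * (δ ^ 2 - y ^ 2) := mul_pos hA (by nlinarith)
    have hyx : A * (δ ^ 2 - y ^ 2) ≤ A * (δ ^ 2 - x ^ 2) := by gcongr
    have hpow : (A * (δ ^ 2 - y ^ 2)) ^ (k + 3) ≤ (A * (δ ^ 2 - x ^ 2)) ^ (k + 3) := by gcongr
    have hpos := pow_pos hpy (k + 3)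
    rw [sgm, sgm, abs_of_nonneg hx, abs_of_nonneg hy, if_neg h.not_ge, if_neg hxδ.not_ge,
      div_le_div_iff₀ (add_pos_of_pos_of_nonneg (hpos.trans_le hpow) hx)
        (add_pos_of_pos_of_nonneg hpos hy)]
    linarith [mul_le_mul hxy hpow hpos.le hy]

theorem affine_sgm_mem_Icc (k : ℕ) {δ A : ℝ} (hA : 0 ≤ A) {a b : ℝ} (hab : a ≤ b) (x : ℝ) :
    (b - a) / 2 * sgm k δ A x + (a + b) / 2 ∈ Set.Icc a b := by
  obtain ⟨h₁, h₂⟩ := abs_le.1 (abs_sgm_le_one k (δ := δ) hA x)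
  constructor <;> nlinarith

theorem gACM_mem_Icc_of_le (k : ℕ) {d A CFS δ ω : ℝ} (hA : 0 ≤ A) (hd : 0 ≤ d) (hω : ω ≤ d) :
    gACM d k A CFS δ ω ∈ Set.Icc 0 d := by
  simpa [gACM, hω] using affine_sgm_mem_Icc k (δ := δ) hA hd (ω - CFS)

theorem gACM_mem_Icc_of_lt (k : ℕ) {d A CFS δ ω : ℝ} (hA : 0 ≤ A) (hd : d ≤ 1) (hω : d < ω) :
    gACM d k A CFS δ ω ∈ Set.Icc d 1 := by
  simpa [gACM, hω.not_ge, add_comm 1 d] using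
    affine_sgm_mem_Icc k (δ := δ) hA hd (ω - CFSbar d CFS)

theorem gACM_monotone (k : ℕ) {d A CFS δ : ℝ} (hd0 : 0 ≤ d) (hd1 : d ≤ 1) (hA : 0 < A)
    (hδ : 0 < δ) : Monotone (gACM d k A CFS δ) := by
  intro x y hxy
  have hsgm := sgm_monotone k hA hδ
  rcases le_or_gt y d with hy | hy
  · rw [gACM, gACM, if_pos (hxy.trans hy), if_pos hy]
    gcongr
    exact hsgm (by gcongr)
  rcases le_or_gt x d with hx | hx
  · exact (gACM_mem_Icc_of_le k hA.le hd0 hx).2.trans (gACM_mem_Icc_of_lt k hA.le hd1 hy).1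
  · rw [gACM, gACM, if_neg hx.not_ge, if_neg hy.not_ge]
    have : 0 ≤ (1 - d) / 2 := by linarith
    gcongr
    exact hsgm (by gcongr)

theorem gACM_monotone_and_range (d : ℝ) (hd0 : 0 < d) (hd1 : d < 1) (k : ℕ) (hk : 1 ≤ k)
    (A CFS δ : ℝ) (hA : 0 < A) (hc0 : 0 < CFS) (hcd : CFS < d) (hδ0 : 0 < δ)
    (hδ : δ < min CFS (min (d - CFS) (min ((1 - d) * (1 - CFS / d)) ((1 - d) / d * CFS)))) :
    MonotoneOn (gACM d k A CFS δ) (Set.Icc (0 : ℝ) 1) ∧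
      ∀ ω ∈ Set.Icc (0 : ℝ) 1, 0 ≤ gACM d k A CFS δ ω ∧ gACM d k A CFS δ ω ≤ 1 := by
  refine ⟨(gACM_monotone k hd0.le hd1.le hA hδ0).monotoneOn _, fun ω _ => ?_⟩
  rcases le_or_gt ω d with h | h
  · obtain ⟨h₁, h₂⟩ := gACM_mem_Icc_of_le k (CFS := CFS) (δ := δ) hA.le hd0.le h
    exact ⟨h₁, h₂.trans hd1.le⟩
  · obtain ⟨h₁, h₂⟩ := gACM_mem_Icc_of_lt k (CFS := CFS) (δ := δ) hA.le hd1.le h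
    exact ⟨hd0.le.trans h₁, h₂⟩
end
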